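/- With the same frame and hypotheses as above, the component R₁₂₃₄ = R(e₁,e₂,e₃,e₄) satisfies (1/12)[(10 + 6cos²α)k₁ - (10 + 3sin²α)k₂] ≤ R₁₂₃₄ ≤ (1/12)[(10 + 6cos²α)k₂ - (10 + 3sin²α)k₁]. -/

import Mathlib

open scoped RealInnerProductSpace

/-- Sectional curvature in terms of holomorphic sectional curvatures. -/
theorem sec_identity {V : Type*} [NormedAddCommGroup V] [InnerProductSpace ℝ V]
    (R : V →ₗ[ℝ] V →ₗ[ℝ] V →ₗ[ℝ] V →ₗ[ℝ] ℝ) (J : V →ₗ[ℝ] V)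
    (hskew1 : ∀ x y z w, R x y z w = -R y x z w)
    (hskew2 : ∀ x y z w, R x y z w = -R x y w z)
    (hpair : ∀ x y z w, R x y z w = R z w x y)
    (hbianchi : ∀ x y z w, R x y z w + R y z x w + R z x y w = 0)
    (hJ2 : ∀ v, J (J v) = -v)
    (hJinv : ∀ x y z w, R (J x) (J y) z w = R x y z w) (x y : V) :
    32 * R x y x y = 3 * R (x + J y) (J (x + J y)) (x + J y) (J (x + J y))
      + 3 * R (x - J y) (J (x - J y)) (x - J y) (J (x - J y))
      - R (x + y) (J (x + y)) (x + y) (J (x + y))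
      - R (x - y) (J (x - y)) (x - y) (J (x - y))
      - 4 * R x (J x) x (J x) - 4 * R y (J y) y (J y) := by
  have hs : ∀ a b u z w, R (a - b) u z w = R a u z w - R b u z w := fun a b u z w => by
    rw [hskew1 (a - b), hskew1 a, hskew1 b]
    simp only [map_sub, LinearMap.sub_apply]
    ring
  have hself : ∀ x z w, R x x z w = 0 := fun x z w => by linarith [hskew1 x x z w]
  have hyx : ∀ z w, R y (J x) z w = R x (J y) z w := fun z w => by
    have h := hJinv x (J y) z w
    rw [hJ2] at h
    simp only [map_neg, LinearMap.neg_apply] at h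
    linarith [hskew1 y (J x) z w]
  have q1 : ∀ z w, R (x + J y) (J (x + J y)) z w
      = R x (J x) z w + R y (J y) z w - 2 * R x y z w := fun z w => by
    simp only [map_add, LinearMap.add_apply, hJ2, map_neg, LinearMap.neg_apply]
    linarith [hJinv x y z w, hskew1 (J y) (J x) z w, hskew1 (J y) y z w]
  have q2 : ∀ z w, R (x - J y) (J (x - J y)) z w
      = R x (J x) z w + R y (J y) z w + 2 * R x y z w := fun z w => by
    simp only [hs, map_sub, LinearMap.sub_apply, hJ2, map_neg, LinearMap.neg_apply]
    linarith [hJinv x y z w, hskew1 (J y) (J x) z w, hskew1 (J y) y z w]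
  have q3 : ∀ z w, R (x + y) (J (x + y)) z w
      = R x (J x) z w + R y (J y) z w + 2 * R x (J y) z w := fun z w => by
    simp only [map_add, LinearMap.add_apply]
    linarith [hyx z w]
  have q4 : ∀ z w, R (x - y) (J (x - y)) z w
      = R x (J x) z w + R y (J y) z w - 2 * R x (J y) z w := fun z w => by
    simp only [hs, map_sub, LinearMap.sub_apply]
    linarith [hyx z w]
  rw [q1, q2, q3, q4]
  simp only [hpair _ _ (x + J y) _, hpair _ _ (x - J y) _, hpair _ _ (x + y) _,
    hpair _ _ (x - y) _, q1, q2, q3, q4]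
  have b := hbianchi x (J x) y (J y)
  have b1 : R (J x) y x (J y) = - R x (J y) x (J y) := by
    rw [hskew1, hyx]
  have b2 : R y x (J x) (J y) = - R x y x y := by
    rw [hskew1, hpair, hJinv]
  linarith [hpair x (J x) y (J y), hpair x (J x) x y, hpair y (J y) x y,
    hpair x (J x) x (J y), hpair y (J y) x (J y)]

theorem sec_bounds {V : Type*} [NormedAddCommGroup V] [InnerProductSpace ℝ V]
    (R : V →ₗ[ℝ] V →ₗ[ℝ] V →ₗ[ℝ] V →ₗ[ℝ] ℝ) (J : V →ₗ[ℝ] V)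
    (hskew1 : ∀ x y z w, R x y z w = -R y x z w)
    (hskew2 : ∀ x y z w, R x y z w = -R x y w z)
    (hpair : ∀ x y z w, R x y z w = R z w x y)
    (hbianchi : ∀ x y z w, R x y z w + R y z x w + R z x y w = 0)
    (hJ2 : ∀ v, J (J v) = -v)
    (hJiso : ∀ v w : V, ⟪J v, J w⟫ = ⟪v, w⟫)
    (hJinv : ∀ x y z w, R (J x) (J y) z w = R x y z w)
    (k₁ k₂ : ℝ)
    (hlow : ∀ v : V, k₁ * ‖v‖ ^ 4 ≤ R v (J v) v (J v))
    (hhigh : ∀ v : V, R v (J v) v (J v) ≤ k₂ * ‖v‖ ^ 4)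
    (x y : V) (t : ℝ) (hx : ⟪x, x⟫ = 2) (hy : ⟪y, y⟫ = 2) (hxy : ⟪x, y⟫ = 0)
    (ht : ⟪x, J y⟫ = 2 * t) :
    3 * (1 + t ^ 2) * k₁ - 2 * k₂ ≤ R x y x y ∧
      R x y x y ≤ 3 * (1 + t ^ 2) * k₂ - 2 * k₁ := by
  have hid := sec_identity R J hskew1 hskew2 hpair hbianchi hJ2 hJinv x y
  have n4 : ∀ v : V, ‖v‖ ^ 4 = ⟪v, v⟫ ^ 2 := fun v => by
    rw [real_inner_self_eq_norm_sq]; ring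
  simp only [n4] at hlow hhigh
  have hyx : ⟪y, x⟫ = 0 := by rw [real_inner_comm]; exact hxy
  have ht' : ⟪J y, x⟫ = 2 * t := by rw [real_inner_comm]; exact ht
  have i1 : ⟪x + J y, x + J y⟫ = 4 + 4 * t := by
    simp only [inner_add_left, inner_add_right, hJiso, hx, hy, ht, ht']; ring
  have i2 : ⟪x - J y, x - J y⟫ = 4 - 4 * t := by
    simp only [inner_sub_left, inner_sub_right, hJiso, hx, hy, ht, ht']; ring
  have i3 : ⟪x + y, x + y⟫ = 4 := by
    simp only [inner_add_left, inner_add_right, hx, hy, hxy, hyx]; ring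
  have i4 : ⟪x - y, x - y⟫ = 4 := by
    simp only [inner_sub_left, inner_sub_right, hx, hy, hxy, hyx]; ring
  have l1 := hlow (x + J y)
  have l2 := hlow (x - J y)
  have l3 := hlow (x + y)
  have l4 := hlow (x - y)
  have l5 := hlow x
  have l6 := hlow y
  have u1 := hhigh (x + J y)
  have u2 := hhigh (x - J y)
  have u3 := hhigh (x + y)
  have u4 := hhigh (x - y)
  have u5 := hhigh x
  have u6 := hhigh y
  rw [i1] at l1 u1
  rw [i2] at l2 u2
  rw [i3] at l3 u3
  rw [i4] at l4 u4
  rw [hx] at l5 u5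
  rw [hy] at l6 u6
  constructor <;> linarith

theorem octahedral {V : Type*} [NormedAddCommGroup V] [InnerProductSpace ℝ V]
    (R : V →ₗ[ℝ] V →ₗ[ℝ] V →ₗ[ℝ] V →ₗ[ℝ] ℝ)
    (hskew1 : ∀ x y z w, R x y z w = -R y x z w)
    (hskew2 : ∀ x y z w, R x y z w = -R x y w z)
    (hpair : ∀ x y z w, R x y z w = R z w x y)
    (hbianchi : ∀ x y z w, R x y z w + R y z x w + R z x y w = 0) (a b c d : V) :
    24 * R a b c d = R (a + c) (b + d) (a + c) (b + d) - R (a + c) (b - d) (a + c) (b - d)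
      - R (a - c) (b + d) (a - c) (b + d) + R (a - c) (b - d) (a - c) (b - d)
      - R (a + d) (b + c) (a + d) (b + c) + R (a + d) (b - c) (a + d) (b - c)
      + R (a - d) (b + c) (a - d) (b + c) - R (a - d) (b - c) (a - d) (b - c) := by
  have hs : ∀ a b u z w, R (a - b) u z w = R a u z w - R b u z w := fun a b u z w => by
    rw [hskew1 (a - b), hskew1 a, hskew1 b]
    simp only [map_sub, LinearMap.sub_apply]
    ring
  simp only [hs, map_add, map_sub, LinearMap.add_apply, LinearMap.sub_apply]
  linarith [hbianchi a b c d, hpair a b c d, hpair a d c b, hpair a b d c, hpair a c d b,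
    hskew2 a b c d, hskew1 b c a d, hskew2 a d c b, hskew2 a d b c, hskew1 c a b d,
    hskew2 a c b d, hskew2 a c d b, hpair b c a d, hskew2 c b a d, hskew1 b c a d, hskew1 c b a d,
    hskew1 d c a b, hskew1 c d a b, hpair d c a b, hpair c d a b, hpair d b a c, hskew1 d b a c]

set_option linter.unusedSimpArgs false
set_option linter.unusedVariables false
set_option maxHeartbeats 4000000

theorem stmt_8 {V : Type*} [NormedAddCommGroup V] [InnerProductSpace ℝ V]
    (R : V →ₗ[ℝ] V →ₗ[ℝ] V →ₗ[ℝ] V →ₗ[ℝ] ℝ) (J : V →ₗ[ℝ] V)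
    (hskew1 : ∀ x y z w, R x y z w = -R y x z w)
    (hskew2 : ∀ x y z w, R x y z w = -R x y w z)
    (hpair : ∀ x y z w, R x y z w = R z w x y)
    (hbianchi : ∀ x y z w, R x y z w + R y z x w + R z x y w = 0)
    (hJ2 : ∀ v, J (J v) = -v)
    (hJiso : ∀ v w : V, ⟪J v, J w⟫ = ⟪v, w⟫)
    (hJinv : ∀ x y z w, R (J x) (J y) z w = R x y z w)
    (k₁ k₂ : ℝ) (hk₁ : 0 < k₁)
    (hlow : ∀ v : V, k₁ * ‖v‖ ^ 4 ≤ R v (J v) v (J v))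
    (hhigh : ∀ v : V, R v (J v) v (J v) ≤ k₂ * ‖v‖ ^ 4)
    (e : Fin 4 → V) (he : Orthonormal ℝ e)
    (c y z : ℝ) (hcyz : c ^ 2 + y ^ 2 + z ^ 2 = 1)
    (hJ1 : J (e 0) = c • e 1 + y • e 2 + z • e 3)
    (hJ2e : J (e 1) = -c • e 0 + z • e 2 - y • e 3)
    (hJ3 : J (e 2) = -y • e 0 - z • e 1 + c • e 3)
    (hJ4 : J (e 3) = -z • e 0 + y • e 1 - c • e 2) :
    (1 / 12) * ((10 + 6 * c ^ 2) * k₁ - (10 + 3 * (y ^ 2 + z ^ 2)) * k₂)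
      ≤ R (e 0) (e 1) (e 2) (e 3) ∧
    R (e 0) (e 1) (e 2) (e 3)
      ≤ (1 / 12) * ((10 + 6 * c ^ 2) * k₂ - (10 + 3 * (y ^ 2 + z ^ 2)) * k₁) := by
  have h := octahedral R hskew1 hskew2 hpair hbianchi (e 0) (e 1) (e 2) (e 3)
  have B := sec_bounds R J hskew1 hskew2 hpair hbianchi hJ2 hJiso hJinv k₁ k₂ hlow hhigh
  have ho : ∀ i j, ⟪e i, e j⟫ = if i = j then (1 : ℝ) else 0 := orthonormal_iff_ite.mp he
  have np : ∀ i j, i ≠ j → ⟪e i + e j, e i + e j⟫ = 2 := fun i j hij => by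
    simp only [inner_add_left, inner_add_right, ho, if_neg hij, if_neg hij.symm, if_true]
    norm_num
  have nm : ∀ i j, i ≠ j → ⟪e i - e j, e i - e j⟫ = 2 := fun i j hij => by
    simp only [inner_sub_left, inner_sub_right, ho, if_neg hij, if_neg hij.symm, if_true]
    norm_num
  have b0 := B (e 0 + e 2) (e 1 + e 3) (-c) (np 0 2 (by decide)) (np 1 3 (by decide))
    (by simp [inner_add_left, inner_add_right, inner_sub_left, inner_sub_right, ho]) (by
    simp only [map_add, map_sub, hJ2e, hJ3, hJ4, inner_add_left, inner_add_right, inner_sub_left,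
      inner_sub_right, inner_smul_right, ho]
    simp
    try ring)
  have b1 := B (e 0 + e 2) (e 1 - e 3) (z) (np 0 2 (by decide)) (nm 1 3 (by decide))
    (by simp [inner_add_left, inner_add_right, inner_sub_left, inner_sub_right, ho]) (by
    simp only [map_add, map_sub, hJ2e, hJ3, hJ4, inner_add_left, inner_add_right, inner_sub_left,
      inner_sub_right, inner_smul_right, ho]
    simp
    try ring)
  have b2 := B (e 0 - e 2) (e 1 + e 3) (-z) (nm 0 2 (by decide)) (np 1 3 (by decide))
    (by simp [inner_add_left, inner_add_right, inner_sub_left, inner_sub_right, ho]) (by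
    simp only [map_add, map_sub, hJ2e, hJ3, hJ4, inner_add_left, inner_add_right, inner_sub_left,
      inner_sub_right, inner_smul_right, ho]
    simp
    try ring)
  have b3 := B (e 0 - e 2) (e 1 - e 3) (-c) (nm 0 2 (by decide)) (nm 1 3 (by decide))
    (by simp [inner_add_left, inner_add_right, inner_sub_left, inner_sub_right, ho]) (by
    simp only [map_add, map_sub, hJ2e, hJ3, hJ4, inner_add_left, inner_add_right, inner_sub_left,
      inner_sub_right, inner_smul_right, ho]
    simp
    try ring)
  have b4 := B (e 0 + e 3) (e 1 + e 2) (-y) (np 0 3 (by decide)) (np 1 2 (by decide))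
    (by simp [inner_add_left, inner_add_right, inner_sub_left, inner_sub_right, ho]) (by
    simp only [map_add, map_sub, hJ2e, hJ3, hJ4, inner_add_left, inner_add_right, inner_sub_left,
      inner_sub_right, inner_smul_right, ho]
    simp
    try ring)
  have b5 := B (e 0 + e 3) (e 1 - e 2) (-c) (np 0 3 (by decide)) (nm 1 2 (by decide))
    (by simp [inner_add_left, inner_add_right, inner_sub_left, inner_sub_right, ho]) (by
    simp only [map_add, map_sub, hJ2e, hJ3, hJ4, inner_add_left, inner_add_right, inner_sub_left,
      inner_sub_right, inner_smul_right, ho]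
    simp
    try ring)
  have b6 := B (e 0 - e 3) (e 1 + e 2) (-c) (nm 0 3 (by decide)) (np 1 2 (by decide))
    (by simp [inner_add_left, inner_add_right, inner_sub_left, inner_sub_right, ho]) (by
    simp only [map_add, map_sub, hJ2e, hJ3, hJ4, inner_add_left, inner_add_right, inner_sub_left,
      inner_sub_right, inner_smul_right, ho]
    simp
    try ring)
  have b7 := B (e 0 - e 3) (e 1 - e 2) (y) (nm 0 3 (by decide)) (nm 1 2 (by decide))
    (by simp [inner_add_left, inner_add_right, inner_sub_left, inner_sub_right, ho]) (by
    simp only [map_add, map_sub, hJ2e, hJ3, hJ4, inner_add_left, inner_add_right, inner_sub_left,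
      inner_sub_right, inner_smul_right, ho]
    simp
    try ring)
  constructor <;> linarith [b0.1, b0.2, b1.1, b1.2, b2.1, b2.2, b3.1, b3.2, b4.1, b4.2,
    b5.1, b5.2, b6.1, b6.2, b7.1, b7.2]
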